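/- Let (G, w) be a complete graph on vertices v_1,…,v_n with integer edge weights and let (G', w', C) be the instance constructed from it as described. If (E⁻, E⁺) is an improving 4-move for C in (G', w'), then there exist indices i < j < k such that E⁻ = {(a_i, b_i), (a_j, b_j), (a_k, b_k), (a_k', b_k')} and E⁺ = {(a_i, b_j), (a_j, b_k), (a_k, b_k'), (a_k', b_i)}, and moreover w(v_i,v_j) + w(v_j,v_k) + w(v_k,v_i) < 0, i.e., v_i, v_j, v_k is a negative triangle in (G, w). -/

import Mathlib

/-- The vertex set of `G'`: `(i, 0) = a_{i+1}`, `(i, 1) = b_{i+1}`,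
`(i, 2) = a'_{i+1}`, `(i, 3) = b'_{i+1}` (0-indexed `i : Fin n`). -/
abbrev Vp (n : ℕ) := Fin n × Fin 4

/-- The vertex sequence of the Hamiltonian cycle
`C = a_1, b_1, …, a_n, b_n, b_n', a_n', …, b_1', a_1'`. -/
def cSeq (n : ℕ) (t : Fin (4 * n)) : Vp n :=
  if h : t.val < 2 * n then
    (⟨t.val / 2, by omega⟩, if t.val % 2 = 0 then 0 else 1)
  else
    (⟨(4 * n - 1 - t.val) / 2, by have := t.isLt; omega⟩,
      if (4 * n - 1 - t.val) % 2 = 0 then 2 else 3)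

/-- The edge set of the Hamiltonian cycle `C`. -/
def cEdges (n : ℕ) : Set (Sym2 (Vp n)) :=
  { e | ∃ t : Fin (4 * n),
      e = s(cSeq n t, cSeq n ⟨(t.val + 1) % (4 * n), Nat.mod_lt _ (by have := t.isLt; omega)⟩) }

/-- `E` is the edge set of a Hamiltonian cycle (of the complete graph on `V`). -/
def IsHamCycleEdgeSet {V : Type*} [Fintype V] [DecidableEq V] (E : Set (Sym2 V)) : Prop :=
  ∃ (u : V) (p : (SimpleGraph.fromEdgeSet E).Walk u u),
    p.IsHamiltonianCycle ∧ ∀ e, e ∈ E ↔ e ∈ p.edges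

/-- `M₁ = 5W + 1`. -/
def M1 (W : ℤ) : ℤ := 5 * W + 1

/-- `M₂ = 21·M₁ + 1`. -/
def M2 (W : ℤ) : ℤ := 21 * M1 W + 1

/-- The pairs of vertices of `G'` whose weight is given by one of the explicit
cases in the definition of `w'` (all remaining pairs get weight `M₂`). -/
def SpecialPair (n : ℕ) (hn : 0 < n) (e : Sym2 (Vp n)) : Prop :=
  (∃ i : Fin n, e = s((i, 0), (i, 3))) ∨
  (∃ i j : Fin n, i < j ∧ e = s((i, 0), (j, 1))) ∨
  (∃ i j : Fin n, j < i ∧ e = s((i, 2), (j, 1))) ∨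
  (∃ i : Fin n, e = s((i, 0), (i, 1))) ∨
  (∃ i : Fin n, e = s((i, 2), (i, 3))) ∨
  (∃ i j : Fin n, (i : ℕ) + 1 = (j : ℕ) ∧ (e = s((i, 1), (j, 0)) ∨ e = s((i, 3), (j, 2)))) ∨
  e = s(((⟨0, hn⟩ : Fin n), 0), ((⟨0, hn⟩ : Fin n), 2)) ∨
  e = s(((⟨n - 1, by omega⟩ : Fin n), 1), ((⟨n - 1, by omega⟩ : Fin n), 3))

/-- `w'` is the weight function of the constructed instance `(G', w', C)`. -/
def IsReductionWeight (n : ℕ) (hn : 0 < n) (w : Sym2 (Fin n) → ℤ) (W : ℤ)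
    (w' : Sym2 (Vp n) → ℤ) : Prop :=
  (∀ i : Fin n, w' s((i, 0), (i, 3)) = 0) ∧
  (∀ i j : Fin n, i < j → w' s((i, 0), (j, 1)) = w s(i, j)) ∧
  (∀ i j : Fin n, j < i → w' s((i, 2), (j, 1)) = w s(i, j)) ∧
  (∀ i : Fin n, w' s((i, 0), (i, 1)) = M1 W) ∧
  (∀ i : Fin n, w' s((i, 2), (i, 3)) = -3 * M1 W) ∧
  (∀ i j : Fin n, (i : ℕ) + 1 = (j : ℕ) →
    w' s((i, 1), (j, 0)) = -(M2 W) ∧ w' s((i, 3), (j, 2)) = -(M2 W)) ∧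
  (w' s(((⟨0, hn⟩ : Fin n), 0), ((⟨0, hn⟩ : Fin n), 2)) = -(M2 W)) ∧
  (w' s(((⟨n - 1, by omega⟩ : Fin n), 1), ((⟨n - 1, by omega⟩ : Fin n), 3)) = -(M2 W)) ∧
  (∀ e : Sym2 (Vp n), ¬ SpecialPair n hn e → w' e = M2 W)

/-- `(Em, Ep)` is an improving `4`-move for the tour `C` in `(G', w')`. -/
def IsImproving4Move (n : ℕ) (w' : Sym2 (Vp n) → ℤ) (Em Ep : Set (Sym2 (Vp n))) : Prop :=
  Em.ncard = 4 ∧ Ep.ncard = 4 ∧ Em ⊆ cEdges n ∧ (∀ e ∈ Ep, ¬ e.IsDiag) ∧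
    IsHamCycleEdgeSet ((cEdges n \ Em) ∪ Ep) ∧
    (∑ᶠ e ∈ ((cEdges n \ Em) ∪ Ep), w' e) < ∑ᶠ e ∈ cEdges n, w' e

/-- The edges of `C` of weight `-M₂`. -/
def Connector (n : ℕ) (hn : 0 < n) (e : Sym2 (Vp n)) : Prop :=
  (∃ i j : Fin n, (i : ℕ) + 1 = (j : ℕ) ∧ (e = s((i, 1), (j, 0)) ∨ e = s((i, 3), (j, 2)))) ∨
  e = s(((⟨0, hn⟩ : Fin n), 0), ((⟨0, hn⟩ : Fin n), 2)) ∨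
  e = s(((⟨n - 1, by omega⟩ : Fin n), 1), ((⟨n - 1, by omega⟩ : Fin n), 3))

lemma cSeq_eq_a {n : ℕ} {t : Fin (4 * n)} {i : Fin n} (h : t.val = 2 * i.val) :
    cSeq n t = (i, 0) := by
  have := i.isLt
  simp only [cSeq]
  rw [dif_pos (by omega), if_pos (by omega)]
  exact Prod.ext (Fin.ext (by simp only; omega)) rfl

lemma cSeq_eq_b {n : ℕ} {t : Fin (4 * n)} {i : Fin n} (h : t.val = 2 * i.val + 1) :
    cSeq n t = (i, 1) := by
  have := i.isLt
  simp only [cSeq]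
  rw [dif_pos (by omega), if_neg (by omega)]
  exact Prod.ext (Fin.ext (by simp only; omega)) rfl

lemma cSeq_eq_a' {n : ℕ} {t : Fin (4 * n)} {i : Fin n} (h : t.val + 2 * i.val + 1 = 4 * n) :
    cSeq n t = (i, 2) := by
  have := i.isLt
  simp only [cSeq]
  rw [dif_neg (by omega), if_pos (by omega)]
  exact Prod.ext (Fin.ext (by simp only; omega)) rfl

lemma cSeq_eq_b' {n : ℕ} {t : Fin (4 * n)} {i : Fin n} (h : t.val + 2 * i.val + 2 = 4 * n) :
    cSeq n t = (i, 3) := by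
  have := i.isLt
  simp only [cSeq]
  rw [dif_neg (by omega), if_neg (by omega)]
  exact Prod.ext (Fin.ext (by simp only; omega)) rfl

lemma mem_cEdges_of_succ {n : ℕ} {u v : Vp n} (t t' : Fin (4 * n))
    (h : t'.val = (t.val + 1) % (4 * n)) (hu : cSeq n t = u) (hv : cSeq n t' = v) :
    s(u, v) ∈ cEdges n := by
  obtain ⟨t', ht'⟩ := t'
  subst h hu hv
  exact ⟨t, rfl⟩

lemma mem_cEdges_iff {n : ℕ} (hn : 0 < n) (e : Sym2 (Vp n)) :
    e ∈ cEdges n ↔ (∃ i : Fin n, e = s((i, 0), (i, 1))) ∨ (∃ i : Fin n, e = s((i, 2), (i, 3))) ∨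
      Connector n hn e := by
  constructor
  · rintro ⟨t, rfl⟩
    have ht := t.isLt
    by_cases h : t.val < 2 * n
    · by_cases h2 : t.val % 2 = 0
      · left
        refine ⟨⟨t.val / 2, by omega⟩, ?_⟩
        rw [cSeq_eq_a (i := ⟨t.val / 2, by omega⟩) (by simp only; omega),
          cSeq_eq_b (i := ⟨t.val / 2, by omega⟩)
            (by simp only; rw [Nat.mod_eq_of_lt (by omega)]; omega)]
      · right; right
        rw [cSeq_eq_b (t := t) (i := ⟨t.val / 2, by omega⟩) (by simp only; omega)]
        by_cases h3 : t.val + 1 = 2 * n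
        · right; right
          rw [cSeq_eq_b' (i := ⟨n - 1, by omega⟩)
            (by simp only; rw [Nat.mod_eq_of_lt (by omega)]; omega)]
          have : t.val / 2 = n - 1 := by omega
          simp only [this]
        · left
          refine ⟨⟨t.val / 2, by omega⟩, ⟨t.val / 2 + 1, by omega⟩, rfl, Or.inl ?_⟩
          rw [cSeq_eq_a (i := ⟨t.val / 2 + 1, by omega⟩)
            (by simp only; rw [Nat.mod_eq_of_lt (by omega)]; omega)]
    · by_cases h2 : t.val % 2 = 0
      · right; left
        refine ⟨⟨(4 * n - 1 - t.val) / 2, by omega⟩, ?_⟩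
        rw [cSeq_eq_b' (i := ⟨(4 * n - 1 - t.val) / 2, by omega⟩) (by simp only; omega),
          cSeq_eq_a' (i := ⟨(4 * n - 1 - t.val) / 2, by omega⟩)
            (by simp only; rw [Nat.mod_eq_of_lt (by omega)]; omega), Sym2.eq_swap]
      · right; right
        rw [cSeq_eq_a' (t := t) (i := ⟨(4 * n - 1 - t.val) / 2, by omega⟩) (by simp only; omega)]
        by_cases h3 : t.val + 1 = 4 * n
        · right; left
          rw [cSeq_eq_a (i := ⟨0, hn⟩) (by simp only [h3, Nat.mod_self, mul_zero])]
          have : (4 * n - 1 - t.val) / 2 = 0 := by omega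
          simp only [this]
          exact Sym2.eq_swap
        · left
          refine ⟨⟨(4 * n - 1 - t.val) / 2 - 1, by omega⟩, ⟨(4 * n - 1 - t.val) / 2, by omega⟩,
            by simp only; omega, Or.inr ?_⟩
          rw [cSeq_eq_b' (i := ⟨(4 * n - 1 - t.val) / 2 - 1, by omega⟩)
            (by simp only; rw [Nat.mod_eq_of_lt (by omega)]; omega), Sym2.eq_swap]
  · rintro (⟨i, rfl⟩ | ⟨i, rfl⟩ | ⟨i, j, hij, rfl | rfl⟩ | rfl | rfl)
    · have := i.isLt
      exact mem_cEdges_of_succ ⟨2 * i, by omega⟩ ⟨2 * i + 1, by omega⟩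
        (by simp only; rw [Nat.mod_eq_of_lt (by omega)]) (cSeq_eq_a rfl) (cSeq_eq_b rfl)
    · have := i.isLt
      rw [Sym2.eq_swap]
      exact mem_cEdges_of_succ ⟨4 * n - 2 * i - 2, by omega⟩ ⟨4 * n - 2 * i - 1, by omega⟩
        (by simp only; rw [Nat.mod_eq_of_lt (by omega)]; omega)
        (cSeq_eq_b' (by simp only; omega)) (cSeq_eq_a' (by simp only; omega))
    · have := j.isLt
      exact mem_cEdges_of_succ ⟨2 * i + 1, by omega⟩ ⟨2 * i + 2, by omega⟩
        (by simp only; rw [Nat.mod_eq_of_lt (by omega)]) (cSeq_eq_b rfl)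
        (cSeq_eq_a (by simp only; omega))
    · have := j.isLt
      rw [Sym2.eq_swap]
      exact mem_cEdges_of_succ ⟨4 * n - 2 * j - 1, by omega⟩ ⟨4 * n - 2 * j, by omega⟩
        (by simp only; rw [Nat.mod_eq_of_lt (by omega)]; omega)
        (cSeq_eq_a' (by simp only; omega)) (cSeq_eq_b' (by simp only; omega))
    · rw [Sym2.eq_swap]
      exact mem_cEdges_of_succ ⟨4 * n - 1, by omega⟩ ⟨0, by omega⟩
        (by simp only; rw [Nat.sub_add_cancel (by omega), Nat.mod_self])
        (cSeq_eq_a' (by simp only; omega)) (cSeq_eq_a rfl)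
    · exact mem_cEdges_of_succ ⟨2 * n - 1, by omega⟩ ⟨2 * n, by omega⟩
        (by simp only; rw [Nat.mod_eq_of_lt (by omega)]; omega)
        (cSeq_eq_b (by simp only; omega)) (cSeq_eq_b' (by simp only; omega))

lemma ncard_neighbors_cEdges {n : ℕ} (hn : 0 < n) (v : Vp n) :
    {u | s(v, u) ∈ cEdges n}.ncard = 2 := by
  obtain ⟨i, c⟩ := v
  have hi := i.isLt
  rw [Set.ncard_eq_two]
  fin_cases c
  · refine ⟨(i, 1), if h : i.val = 0 then (i, 2) else (⟨i - 1, by omega⟩, 1), ?_, ?_⟩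
    · split_ifs <;> simp [Fin.ext_iff]; omega
    · ext ⟨j, d⟩
      split_ifs <;> fin_cases d <;>
        simp [mem_cEdges_iff hn, Connector, Fin.ext_iff] <;> grind
  · refine ⟨(i, 0), if h : i.val = n - 1 then (i, 3) else (⟨i + 1, by omega⟩, 0), ?_, ?_⟩
    · split_ifs <;> simp [Fin.ext_iff]
    · ext ⟨j, d⟩
      split_ifs <;> fin_cases d <;>
        simp [mem_cEdges_iff hn, Connector, Fin.ext_iff] <;> grind
  · refine ⟨(i, 3), if h : i.val = 0 then (i, 0) else (⟨i - 1, by omega⟩, 3), ?_, ?_⟩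
    · split_ifs <;> simp [Fin.ext_iff]; omega
    · ext ⟨j, d⟩
      split_ifs <;> fin_cases d <;>
        simp [mem_cEdges_iff hn, Connector, Fin.ext_iff] <;> grind
  · refine ⟨(i, 2), if h : i.val = n - 1 then (i, 1) else (⟨i + 1, by omega⟩, 2), ?_, ?_⟩
    · split_ifs <;> simp [Fin.ext_iff]
    · ext ⟨j, d⟩
      split_ifs <;> fin_cases d <;>
        simp [mem_cEdges_iff hn, Connector, Fin.ext_iff] <;> grind

lemma IsHamCycleEdgeSet.ncard_neighbors {V : Type*} [Fintype V] [DecidableEq V]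
    {E : Set (Sym2 V)} (h : IsHamCycleEdgeSet E) (v : V) : {u | s(v, u) ∈ E}.ncard = 2 := by
  obtain ⟨u, p, hp, hE⟩ := h
  rw [← hp.isCycle.ncard_neighborSet_toSubgraph_eq_two (hp.mem_support v)]
  congr 1
  ext x
  rw [Set.mem_ofPred_eq, hE, SimpleGraph.Subgraph.mem_neighborSet,
    SimpleGraph.Walk.adj_toSubgraph_iff_mem_edges]

lemma ncard_neighbors_sdiff {V : Type*} [Fintype V] {E F : Set (Sym2 V)} {v : V}
    (h : {u | s(v, u) ∈ E}.ncard = {u | s(v, u) ∈ F}.ncard) :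
    {u | s(v, u) ∈ E \ F}.ncard = {u | s(v, u) ∈ F \ E}.ncard := by
  classical
  have h1 := Set.ncard_inter_add_ncard_sdiff_eq_ncard {u | s(v, u) ∈ E} {u | s(v, u) ∈ F}
  have h2 := Set.ncard_inter_add_ncard_sdiff_eq_ncard {u | s(v, u) ∈ F} {u | s(v, u) ∈ E}
  rw [Set.inter_comm] at h2
  have e1 : {u | s(v, u) ∈ E \ F} = {u | s(v, u) ∈ E} \ {u | s(v, u) ∈ F} := rfl
  have e2 : {u | s(v, u) ∈ F \ E} = {u | s(v, u) ∈ F} \ {u | s(v, u) ∈ E} := rfl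
  rw [e1, e2]
  omega

lemma sum_le_four_mul {α : Type*} {S : Finset α} {f : α → ℤ} {c : ℤ} (hS : S.card ≤ 4)
    (hc : 0 ≤ c) (hf : ∀ e ∈ S, f e ≤ c) : ∑ e ∈ S, f e ≤ 4 * c := by
  have h := Finset.sum_le_card_nsmul S f c hf
  rw [nsmul_eq_mul] at h
  have : (S.card : ℤ) ≤ 4 := by exact_mod_cast hS
  nlinarith

lemma sum_le_add_four_mul {α : Type*} {S : Finset α} {f : α → ℤ} {c : ℤ} {a : α}
    (hS : S.card ≤ 4) (hc : 0 ≤ c) (hf : ∀ e ∈ S, f e ≤ c) (ha : a ∈ S) :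
    ∑ e ∈ S, f e ≤ f a + 4 * c := by
  classical
  rw [← Finset.add_sum_erase S f ha]
  have := sum_le_four_mul (S := S.erase a) (f := f) ((Finset.card_erase_le).trans hS) hc
    fun e he => hf e (Finset.mem_of_mem_erase he)
  linarith

/-- The edges of `A` join `a_i` to `b_i` or `a_i'` to `b_i'`, the edges of `B` are edges outside
the tour that are not of weight `M₂`, and every vertex has as many edges in `A` as in `B`. -/
structure IsLightExchange {n : ℕ} (A B : Finset (Sym2 (Vp n))) : Prop where
  removed : ∀ e ∈ A, (∃ i : Fin n, e = s((i, 0), (i, 1))) ∨ ∃ i : Fin n, e = s((i, 2), (i, 3))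
  added : ∀ e ∈ B, (∃ i : Fin n, e = s((i, 0), (i, 3))) ∨
    (∃ i j : Fin n, i < j ∧ e = s((i, 0), (j, 1))) ∨
    (∃ i j : Fin n, j < i ∧ e = s((i, 2), (j, 1)))
  ncard_eq : ∀ v, {u | s(v, u) ∈ A}.ncard = {u | s(v, u) ∈ B}.ncard

namespace IsLightExchange

variable {n : ℕ} {A B : Finset (Sym2 (Vp n))}

lemma exists_removed (h : IsLightExchange A B) {v x : Vp n} (hx : s(v, x) ∈ B) :
    ∃ y, s(v, y) ∈ A := by
  have h1 : 0 < {u | s(v, u) ∈ B}.ncard := (Set.ncard_pos (Set.toFinite _)).2 ⟨x, hx⟩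
  rw [← h.ncard_eq v] at h1
  exact (Set.ncard_pos (Set.toFinite _)).1 h1

lemma exists_added (h : IsLightExchange A B) {v x : Vp n} (hx : s(v, x) ∈ A) :
    ∃ y, s(v, y) ∈ B := by
  have h1 : 0 < {u | s(v, u) ∈ A}.ncard := (Set.ncard_pos (Set.toFinite _)).2 ⟨x, hx⟩
  rw [h.ncard_eq v] at h1
  exact (Set.ncard_pos (Set.toFinite _)).1 h1

lemma mem_of_mem_a (h : IsLightExchange A B) {i : Fin n} {x : Vp n} (hx : s((i, 0), x) ∈ B) :
    s((i, 0), (i, 1)) ∈ A := by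
  obtain ⟨y, hy⟩ := h.exists_removed hx
  rcases h.removed _ hy with ⟨j, hj⟩ | ⟨j, hj⟩ <;> simp at hj
  obtain ⟨rfl, rfl⟩ := hj
  exact hy

lemma mem_of_mem_b (h : IsLightExchange A B) {i : Fin n} {x : Vp n} (hx : s(x, (i, 1)) ∈ B) :
    s((i, 0), (i, 1)) ∈ A := by
  rw [Sym2.eq_swap] at hx
  obtain ⟨y, hy⟩ := h.exists_removed hx
  rcases h.removed _ hy with ⟨j, hj⟩ | ⟨j, hj⟩ <;> simp at hj
  obtain ⟨rfl, rfl⟩ := hj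
  rwa [Sym2.eq_swap]

lemma mem_of_mem_a' (h : IsLightExchange A B) {i : Fin n} {x : Vp n} (hx : s((i, 2), x) ∈ B) :
    s((i, 2), (i, 3)) ∈ A := by
  obtain ⟨y, hy⟩ := h.exists_removed hx
  rcases h.removed _ hy with ⟨j, hj⟩ | ⟨j, hj⟩ <;> simp at hj
  obtain ⟨rfl, rfl⟩ := hj
  exact hy

lemma mem_of_mem_b' (h : IsLightExchange A B) {i : Fin n} {x : Vp n} (hx : s(x, (i, 3)) ∈ B) :
    s((i, 2), (i, 3)) ∈ A := by
  rw [Sym2.eq_swap] at hx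
  obtain ⟨y, hy⟩ := h.exists_removed hx
  rcases h.removed _ hy with ⟨j, hj⟩ | ⟨j, hj⟩ <;> simp at hj
  obtain ⟨rfl, rfl⟩ := hj
  rwa [Sym2.eq_swap]

lemma added_a (h : IsLightExchange A B) {i : Fin n} (hi : s((i, 0), (i, 1)) ∈ A) :
    s((i, 0), (i, 3)) ∈ B ∨ ∃ j, i < j ∧ s((i, 0), (j, 1)) ∈ B := by
  obtain ⟨y, hy⟩ := h.exists_added hi
  rcases h.added _ hy with ⟨j, hj⟩ | ⟨j, k, hjk, hj⟩ | ⟨j, k, hjk, hj⟩ <;> simp at hj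
  · obtain ⟨rfl, rfl⟩ := hj
    exact Or.inl hy
  · obtain ⟨rfl, rfl⟩ := hj
    exact Or.inr ⟨k, hjk, hy⟩

lemma added_b (h : IsLightExchange A B) {i : Fin n} (hi : s((i, 0), (i, 1)) ∈ A) :
    (∃ j, j < i ∧ s((j, 0), (i, 1)) ∈ B) ∨ ∃ j, i < j ∧ s((j, 2), (i, 1)) ∈ B := by
  rw [Sym2.eq_swap] at hi
  obtain ⟨y, hy⟩ := h.exists_added hi
  rcases h.added _ hy with ⟨j, hj⟩ | ⟨j, k, hjk, hj⟩ | ⟨j, k, hjk, hj⟩ <;> simp at hj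
  · obtain ⟨rfl, rfl⟩ := hj
    exact Or.inl ⟨j, hjk, by rwa [Sym2.eq_swap]⟩
  · obtain ⟨rfl, rfl⟩ := hj
    exact Or.inr ⟨j, hjk, by rwa [Sym2.eq_swap]⟩

lemma added_b_unique (h : IsLightExchange A B) {i : Fin n} {x y : Vp n}
    (hx : s(x, (i, 1)) ∈ B) (hy : s(y, (i, 1)) ∈ B) : x = y := by
  rw [Sym2.eq_swap] at hx hy
  have h1 : {u | s((i, 1), u) ∈ A} ⊆ {((i, 0) : Vp n)} := by
    intro u hu
    rcases h.removed _ hu with ⟨j, hj⟩ | ⟨j, hj⟩ <;> simp at hj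
    obtain ⟨rfl, rfl⟩ := hj
    rfl
  have h2 := Set.ncard_le_ncard h1
  rw [h.ncard_eq, Set.ncard_singleton] at h2
  exact (Set.ncard_le_one (Set.toFinite _)).1 h2 x hx y hy

/-- The largest index of a removed edge `a_i b_i` is the index of a removed edge `a_i' b_i'`. -/
lemma exists_isGreatest (h : IsLightExchange A B)
    (hne : ∃ i : Fin n, s((i, 0), (i, 1)) ∈ A) :
    ∃ m : Fin n, s((m, 0), (m, 3)) ∈ B ∧ IsGreatest {i : Fin n | s((i, 0), (i, 1)) ∈ A} m := by
  obtain ⟨m, hm⟩ := (Set.toFinite {i : Fin n | s((i, 0), (i, 1)) ∈ A}).exists_maximal hne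
  have hm' : IsGreatest {i : Fin n | s((i, 0), (i, 1)) ∈ A} m :=
    ⟨hm.1, fun j hj => le_of_not_gt fun hlt => absurd (hm.2 hj hlt.le) (not_le_of_gt hlt)⟩
  refine ⟨m, ?_, hm'⟩
  rcases h.added_a hm.1 with h1 | ⟨j, hj, h1⟩
  · exact h1
  · exact absurd (hm'.2 (h.mem_of_mem_b h1)) (not_le_of_gt hj)

/-- The smallest index of a removed edge `a_i b_i` is reached from a primed vertex. -/
lemma exists_isLeast (h : IsLightExchange A B)
    (hne : ∃ i : Fin n, s((i, 0), (i, 1)) ∈ A) :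
    ∃ m k : Fin n, m < k ∧ s((k, 2), (m, 1)) ∈ B ∧
      IsLeast {i : Fin n | s((i, 0), (i, 1)) ∈ A} m := by
  obtain ⟨m, hm⟩ := (Set.toFinite {i : Fin n | s((i, 0), (i, 1)) ∈ A}).exists_minimal hne
  have hm' : IsLeast {i : Fin n | s((i, 0), (i, 1)) ∈ A} m :=
    ⟨hm.1, fun j hj => le_of_not_gt fun hlt => absurd (hm.2 hj hlt.le) (not_le_of_gt hlt)⟩
  rcases h.added_b hm.1 with ⟨j, hj, h1⟩ | ⟨j, hj, h1⟩
  · exact absurd (hm'.2 (h.mem_of_mem_a h1)) (not_le_of_gt hj)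
  · exact ⟨m, j, hj, h1, hm'⟩

lemma removed_nonempty (h : IsLightExchange A B) (hB : B.Nonempty) : A.Nonempty := by
  obtain ⟨e, he⟩ := hB
  induction e with | _ x y
  obtain ⟨z, hz⟩ := h.exists_removed he
  exact ⟨_, hz⟩

lemma sum_removed (h : IsLightExchange A B) {M : Type*} [AddCommMonoid M]
    (f : Sym2 (Vp n) → M) :
    ∑ e ∈ A, f e = ∑ i with s((i, 0), (i, 1)) ∈ A, f s((i, 0), (i, 1)) +
      ∑ i with s((i, 2), (i, 3)) ∈ A, f s((i, 2), (i, 3)) := by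
  classical
  have hA : A = (Finset.univ.filter fun i : Fin n => s((i, 0), (i, 1)) ∈ A).image
        (fun i => s((i, 0), (i, 1))) ∪
      (Finset.univ.filter fun i : Fin n => s((i, 2), (i, 3)) ∈ A).image
        (fun i => s((i, 2), (i, 3))) := by
    ext e
    simp only [Finset.mem_union, Finset.mem_image, Finset.mem_filter, Finset.mem_univ, true_and]
    constructor
    · intro he
      rcases h.removed e he with ⟨i, rfl⟩ | ⟨i, rfl⟩
      · exact Or.inl ⟨i, he, rfl⟩
      · exact Or.inr ⟨i, he, rfl⟩
    · rintro (⟨i, hi, rfl⟩ | ⟨i, hi, rfl⟩) <;> exact hi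
  conv_lhs => rw [hA]
  rw [Finset.sum_union, Finset.sum_image, Finset.sum_image]
  · intro i _ j _ hij
    simpa using hij
  · intro i _ j _ hij
    simpa using hij
  · rw [Finset.disjoint_left]
    simp only [Finset.mem_image]
    rintro _ ⟨i, -, rfl⟩ ⟨j, -, hj⟩
    simp at hj

/-- An exchange that removes at most four edges, at least thrice as many unprimed as primed ones,
is the one that goes around a triangle. -/
lemma eq_triangle (h : IsLightExchange A B) (hA : A.card ≤ 4) (hne : A.Nonempty)
    (hPQ : 3 * (Finset.univ.filter fun i : Fin n => s((i, 2), (i, 3)) ∈ A).card ≤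
      (Finset.univ.filter fun i : Fin n => s((i, 0), (i, 1)) ∈ A).card) :
    ∃ i j k : Fin n, i < j ∧ j < k ∧
      {s((i, 0), (i, 1)), s((j, 0), (j, 1)), s((k, 0), (k, 1)), s((k, 2), (k, 3))} ⊆ A ∧
      {s((i, 0), (j, 1)), s((j, 0), (k, 1)), s((k, 0), (k, 3)), s((k, 2), (i, 1))} ⊆ B := by
  classical
  set P := Finset.univ.filter fun i : Fin n => s((i, 0), (i, 1)) ∈ A with hP
  set Q := Finset.univ.filter fun i : Fin n => s((i, 2), (i, 3)) ∈ A with hQ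
  have memP {i : Fin n} : i ∈ P ↔ s((i, 0), (i, 1)) ∈ A := by simp [hP]
  have memQ {i : Fin n} : i ∈ Q ↔ s((i, 2), (i, 3)) ∈ A := by simp [hQ]
  have hcard : A.card = P.card + Q.card := by
    simpa only [Finset.card_eq_sum_ones] using h.sum_removed fun _ => (1 : ℕ)
  have hPpos : 0 < P.card := by
    have := hne.card_pos
    omega
  obtain ⟨p, hp⟩ := Finset.card_pos.1 hPpos
  obtain ⟨k, hk, hkmax⟩ := h.exists_isGreatest ⟨p, memP.1 hp⟩
  obtain ⟨i, k', hik, hi, himin⟩ := h.exists_isLeast ⟨p, memP.1 hp⟩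
  have hkQ : k ∈ Q := memQ.2 (h.mem_of_mem_b' hk)
  have hQpos := Finset.card_pos.2 ⟨k, hkQ⟩
  have hQone : Q.card = 1 := by omega
  have hPthree : P.card = 3 := by omega
  have hQeq {l : Fin n} (hl : l ∈ Q) : l = k := Finset.card_le_one.1 hQone.le l hl k hkQ
  obtain rfl := hQeq (memQ.2 (h.mem_of_mem_a' hi))
  have hiP : i ∈ P := memP.2 himin.1
  have hkP : k' ∈ P := memP.2 hkmax.1
  have hE : ((P.erase i).erase k').card = 1 := by
    rw [Finset.card_erase_of_mem (Finset.mem_erase.2 ⟨hik.ne', hkP⟩),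
      Finset.card_erase_of_mem hiP, hPthree]
  obtain ⟨j, hj⟩ := Finset.card_eq_one.1 hE
  have hPj {l : Fin n} (hl : l ∈ P) : l = i ∨ l = j ∨ l = k' := by
    by_contra! hcon
    have : l ∈ (P.erase i).erase k' := by simp [hl, hcon]
    rw [hj, Finset.mem_singleton] at this
    exact hcon.2.1 this
  have hjP : j ∈ (P.erase i).erase k' := by simp [hj]
  simp only [Finset.mem_erase] at hjP
  have hij : i < j := lt_of_le_of_ne (himin.2 (memP.1 hjP.2.2)) (Ne.symm hjP.2.1)
  have hjk : j < k' := lt_of_le_of_ne (hkmax.2 (memP.1 hjP.2.2)) hjP.1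
  have hjB : s((j, 0), (k', 1)) ∈ B := by
    rcases h.added_a (memP.1 hjP.2.2) with h1 | ⟨l, hl, h1⟩
    · exact absurd (hQeq (memQ.2 (h.mem_of_mem_b' h1))) hjP.1
    · rcases hPj (memP.2 (h.mem_of_mem_b h1)) with rfl | rfl | rfl
      · exact absurd hij hl.asymm
      · exact absurd hl (lt_irrefl _)
      · exact h1
  have hiB : s((i, 0), (j, 1)) ∈ B := by
    rcases h.added_a himin.1 with h1 | ⟨l, hl, h1⟩
    · exact absurd (hQeq (memQ.2 (h.mem_of_mem_b' h1))) hik.ne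
    · rcases hPj (memP.2 (h.mem_of_mem_b h1)) with rfl | rfl | rfl
      · exact absurd hl (lt_irrefl _)
      · exact h1
      · exact absurd (congrArg Prod.fst (h.added_b_unique h1 hjB)) hij.ne
  refine ⟨i, j, k', hij, hjk, ?_, ?_⟩
  · simp only [Finset.insert_subset_iff, Finset.singleton_subset_iff]
    exact ⟨himin.1, memP.1 hjP.2.2, hkmax.1, memQ.1 hkQ⟩
  · simp only [Finset.insert_subset_iff, Finset.singleton_subset_iff]
    exact ⟨hiB, hjB, hk, hi⟩

end IsLightExchange

/-- Every improving `4`-move `(E⁻, E⁺)` for `C` in `(G', w')` is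
of the form `E⁻ = {(a_i,b_i), (a_j,b_j), (a_k,b_k), (a_k',b_k')}`,
`E⁺ = {(a_i,b_j), (a_j,b_k), (a_k,b_k'), (a_k',b_i)}` for some `i < j < k`, and
then `v_i, v_j, v_k` is a negative triangle in `(G, w)`. -/
theorem stmt_13 (n : ℕ) (hn : 0 < n) (w : Sym2 (Fin n) → ℤ) (W : ℤ)
    (hW : IsGreatest { x : ℤ | ∃ u v : Fin n, u ≠ v ∧ x = |w s(u, v)| } W)
    (w' : Sym2 (Vp n) → ℤ) (hw' : IsReductionWeight n hn w W w')
    (Em Ep : Set (Sym2 (Vp n))) (hmove : IsImproving4Move n w' Em Ep) :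
    ∃ i j k : Fin n, i < j ∧ j < k ∧
      Em = {s((i, 0), (i, 1)), s((j, 0), (j, 1)), s((k, 0), (k, 1)), s((k, 2), (k, 3))} ∧
      Ep = {s((i, 0), (j, 1)), s((j, 0), (k, 1)), s((k, 0), (k, 3)), s((k, 2), (i, 1))} ∧
      w s(i, j) + w s(j, k) + w s(k, i) < 0 := by
  classical
  obtain ⟨h03, h01, h21, hM, hM', hcon, hcon0, hcon1, hoth⟩ := hw'
  obtain ⟨hEm, hEp, hEmC, -, hham, hlt⟩ := hmove
  obtain ⟨⟨u₀, v₀, -, hWe⟩, hWub⟩ := hW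
  have hW0 : 0 ≤ W := hWe ▸ abs_nonneg _
  have hM1_eq : M1 W = 5 * W + 1 := rfl
  have hM2_eq : M2 W = 21 * M1 W + 1 := rfl
  have hM1 : 0 ≤ M1 W := by linarith
  have hwW {i j : Fin n} (hij : i ≠ j) : |w s(i, j)| ≤ W := hWub ⟨i, j, hij, rfl⟩
  set E' := (cEdges n \ Em) ∪ Ep with hE'
  set A := (cEdges n).toFinset \ E'.toFinset with hA
  set B := E'.toFinset \ (cEdges n).toFinset with hB
  have hAEm : (A : Set (Sym2 (Vp n))) ⊆ Em := by
    intro e he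
    simp only [hA, Finset.coe_sdiff, Set.coe_toFinset] at he
    by_contra hc
    exact he.2 (Or.inl ⟨he.1, hc⟩)
  have hBEp : (B : Set (Sym2 (Vp n))) ⊆ Ep := by
    intro e he
    simp only [hB, Finset.coe_sdiff, Set.coe_toFinset] at he
    exact he.1.resolve_left fun hc => he.2 hc.1
  have hAcard : A.card ≤ 4 := by
    rw [← Set.ncard_coe_finset, ← hEm]
    exact Set.ncard_le_ncard hAEm
  have hBcard : B.card ≤ 4 := by
    rw [← Set.ncard_coe_finset, ← hEp]
    exact Set.ncard_le_ncard hBEp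
  have hsum : ∑ e ∈ B, w' e < ∑ e ∈ A, w' e := by
    rw [Finset.sum_sdiff_lt_sum_sdiff]
    rwa [finsum_mem_eq_toFinset_sum, finsum_mem_eq_toFinset_sum] at hlt
  have hAC : ∀ e ∈ A, (∃ i : Fin n, e = s((i, 0), (i, 1))) ∨ (∃ i : Fin n, e = s((i, 2), (i, 3))) ∨
      w' e = -M2 W := by
    intro e he
    have : e ∈ cEdges n := by
      rw [hA, Finset.mem_sdiff, Set.mem_toFinset] at he
      exact he.1
    rcases (mem_cEdges_iff hn e).1 this with h | h | ⟨i, j, hij, rfl | rfl⟩ | rfl | rfl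
    · exact Or.inl h
    · exact Or.inr (Or.inl h)
    · exact Or.inr (Or.inr (hcon i j hij).1)
    · exact Or.inr (Or.inr (hcon i j hij).2)
    · exact Or.inr (Or.inr hcon0)
    · exact Or.inr (Or.inr hcon1)
  have hBC : ∀ e ∈ B, ((∃ i : Fin n, e = s((i, 0), (i, 3))) ∨
      (∃ i j : Fin n, i < j ∧ e = s((i, 0), (j, 1))) ∨
      (∃ i j : Fin n, j < i ∧ e = s((i, 2), (j, 1)))) ∨ w' e = M2 W := by
    intro e he
    have hC : e ∉ cEdges n := by
      rw [hB, Finset.mem_sdiff, Set.mem_toFinset (s := cEdges n)] at he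
      exact he.2
    by_cases hs : SpecialPair n hn e
    · left
      rw [mem_cEdges_iff hn] at hC
      rcases hs with h | h | h | h | h | h
      · exact Or.inl h
      · exact Or.inr (Or.inl h)
      · exact Or.inr (Or.inr h)
      · exact absurd (Or.inl h) hC
      · exact absurd (Or.inr (Or.inl h)) hC
      · exact absurd (Or.inr (Or.inr h)) hC
    · exact Or.inr (hoth e hs)
  have hAle : ∀ e ∈ A, w' e ≤ M1 W := by
    intro e he
    rcases hAC e he with ⟨i, rfl⟩ | ⟨i, rfl⟩ | h
    · rw [hM]
    · rw [hM']; linarith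
    · rw [h]; linarith
  have hBge : ∀ e ∈ B, -w' e ≤ W := by
    intro e he
    rcases hBC e he with (⟨i, rfl⟩ | ⟨i, j, hij, rfl⟩ | ⟨i, j, hij, rfl⟩) | h
    · rw [h03]; linarith
    · rw [h01 i j hij]; linarith [(abs_le.1 (hwW hij.ne)).1]
    · rw [h21 i j hij]; linarith [(abs_le.1 (hwW hij.ne')).1]
    · rw [h]; linarith
  have hsumA := sum_le_four_mul hAcard hM1 hAle
  have hsumB := sum_le_four_mul hBcard hW0 hBge
  rw [Finset.sum_neg_distrib] at hsumB
  have hex : IsLightExchange A B := by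
    refine ⟨fun e he => ?_, fun e he => ?_, fun v => ?_⟩
    · rcases hAC e he with h | h | h
      · exact Or.inl h
      · exact Or.inr h
      · have := sum_le_add_four_mul hAcard hM1 hAle he
        linarith
    · rcases hBC e he with h | h
      · exact h
      · have := sum_le_add_four_mul hBcard hW0 hBge he
        rw [Finset.sum_neg_distrib] at this
        linarith
    · have := ncard_neighbors_sdiff (v := v)
        ((ncard_neighbors_cEdges hn v).trans (hham.ncard_neighbors v).symm)
      simpa [hA, hB] using this
  have hAsum := hex.sum_removed w'
  simp only [hM, hM', Finset.sum_const, nsmul_eq_mul] at hAsum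
  have hAne : A.Nonempty := by
    by_contra hc
    have hB0 : ¬ B.Nonempty := fun hb => hc (hex.removed_nonempty hb)
    rw [Finset.not_nonempty_iff_eq_empty] at hc hB0
    rw [hc, hB0] at hsum
    exact lt_irrefl _ hsum
  obtain ⟨i, j, k, hij, hjk, hTA, hTB⟩ := hex.eq_triangle hAcard hAne (by
    by_contra! hc
    zify at hc
    nlinarith)
  have hik := hij.trans hjk
  have hTAcard : ({s((i, 0), (i, 1)), s((j, 0), (j, 1)), s((k, 0), (k, 1)),
      s((k, 2), (k, 3))} : Finset (Sym2 (Vp n))).card = 4 := by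
    simp [Finset.card_insert_of_notMem, hij.ne, hjk.ne, hik.ne]
  have hTBcard : ({s((i, 0), (j, 1)), s((j, 0), (k, 1)), s((k, 0), (k, 3)),
      s((k, 2), (i, 1))} : Finset (Sym2 (Vp n))).card = 4 := by
    simp [Finset.card_insert_of_notMem, hij.ne]
  have hA4 := Finset.eq_of_subset_of_card_le hTA (by omega)
  have hB4 := Finset.eq_of_subset_of_card_le hTB (by omega)
  have hAE : (A : Set (Sym2 (Vp n))) = Em := Set.eq_of_subset_of_ncard_le hAEm
    (by rw [Set.ncard_coe_finset, ← hA4]; omega)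
  have hBE : (B : Set (Sym2 (Vp n))) = Ep := Set.eq_of_subset_of_ncard_le hBEp
    (by rw [Set.ncard_coe_finset, ← hB4]; omega)
  refine ⟨i, j, k, hij, hjk, ?_, ?_, ?_⟩
  · rw [← hAE, ← hA4]; simp
  · rw [← hBE, ← hB4]; simp
  · rw [← hA4, ← hB4] at hsum
    simp only [Finset.mem_insert, Finset.mem_singleton, Sym2.eq_iff, Prod.mk.injEq,
      Fin.reduceEq, and_false, false_and, or_false, not_false_eq_true,
      Finset.sum_insert, Finset.sum_singleton, hij.ne, hjk.ne, hik.ne, and_true,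
      and_self, h03, h01 i j hij, h01 j k hjk, h21 k i hik, hM, hM'] at hsum
    linarith
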